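/- Fix an integer N ≥ 1, pairwise distinct positive reals b_1, …, b_N, and set π_i := ∏_{j≠i} b_i/(b_i − b_j). For a > 0 and x ≥ 0 define G(a,x) := 1 − Σ_{i=1}^N π_i · ( (a/b_i)/(x + a/b_i) ) · exp(−x/a) (the CDF of the artificial-noise-degraded SNR with legitimate mean a from Eq. (8) of the paper). Then for every fixed x ≥ 0, lim_{a→∞} a·G(a,x) = x · Σ_{i=1}^N π_i (1 + b_i). -/

import Mathlib

open scoped BigOperators

/-- The partial-fraction weights of pairwise distinct nonzero scalars sum to one: they are the
values at `0` of the Lagrange basis with nodes `(b i)⁻¹`. -/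
theorem sum_prod_div_sub_eq_one {ι F : Type*} [Field F] [Fintype ι] [DecidableEq ι] [Nonempty ι]
    (b : ι → F) (hb : ∀ i, b i ≠ 0) (hinj : Function.Injective b) :
    ∑ i, ∏ j ∈ Finset.univ.filter (· ≠ i), b i / (b i - b j) = 1 := by
  have h := congrArg (Polynomial.eval 0)
    (Lagrange.sum_basis (s := Finset.univ) (v := fun i => (b i)⁻¹)
      (inv_injective.comp hinj).injOn Finset.univ_nonempty)
  rw [Polynomial.eval_finsetSum, Polynomial.eval_one] at h
  rw [← h]
  refine Finset.sum_congr rfl fun i _ => ?_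
  rw [Lagrange.basis, Polynomial.eval_prod]
  refine Finset.prod_congr (by ext; simp) fun j hj => ?_
  have hne : b i - b j ≠ 0 := sub_ne_zero.mpr fun e => Finset.ne_of_mem_erase hj (hinj e.symm)
  have hinv : (b i)⁻¹ - (b j)⁻¹ = -(b i - b j) / (b i * b j) := by
    have := hb i
    have := hb j
    field_simp
    ring
  have := hb i
  have := hb j
  simp only [Lagrange.basisDivisor, Polynomial.eval_mul, Polynomial.eval_C, Polynomial.eval_sub,
    Polynomial.eval_X, hinv]
  field_simp
  ring

/-- First-order expansion at infinity of a single partial-fraction term. -/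
theorem tendsto_mul_one_sub_div_mul_exp {c : ℝ} (hc : 0 < c) (x : ℝ) :
    Filter.Tendsto (fun a : ℝ => a * (1 - (a / c) / (x + a / c) * Real.exp (-x / a)))
      Filter.atTop (nhds (x * (1 + c))) := by
  have hd : HasDerivAt (fun t : ℝ => 1 - Real.exp (-x * t) / (1 + c * x * t)) (x * (1 + c)) 0 := by
    have hexp : HasDerivAt (fun t : ℝ => Real.exp (-x * t)) (-x) 0 := by
      simpa using ((hasDerivAt_id (0 : ℝ)).const_mul (-x)).exp
    have hlin : HasDerivAt (fun t : ℝ => 1 + c * x * t) (c * x) 0 := by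
      simpa using ((hasDerivAt_id (0 : ℝ)).const_mul (c * x)).const_add 1
    refine ((hexp.div hlin (by simp)).const_sub 1).congr_deriv ?_
    simp
    ring
  have hlim := (hasDerivAt_iff_tendsto_slope.mp hd).comp
    (tendsto_inv_atTop_nhdsGT_zero.mono_right (nhdsWithin_mono _ fun t ht => ne_of_gt ht))
  refine hlim.congr' ?_
  filter_upwards [Filter.eventually_gt_atTop 0] with a ha
  have hfrac : (a / c) / (x + a / c) = 1 / (1 + c * x * a⁻¹) := by
    have hden : 1 + c * x * a⁻¹ = (x + a / c) / (a / c) := by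
      field_simp
      ring
    rw [hden, one_div_div]
  simp only [Function.comp_apply, slope_def_field, hfrac]
  simp [div_eq_mul_inv]
  ring

theorem stmt17 (N : ℕ) (hN : 1 ≤ N)
    (b : Fin N → ℝ) (hb : ∀ i, 0 < b i) (hbdist : Function.Injective b)
    (x : ℝ) (hx : 0 ≤ x) :
    Filter.Tendsto
      (fun a : ℝ => a * (1 - ∑ i,
        (∏ j ∈ Finset.univ.filter (· ≠ i), b i / (b i - b j))
          * ((a / b i) / (x + a / b i)) * Real.exp (-x / a)))
      Filter.atTop
      (nhds (x * ∑ i,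
        (∏ j ∈ Finset.univ.filter (· ≠ i), b i / (b i - b j)) * (1 + b i))) := by
  have : Nonempty (Fin N) := ⟨⟨0, hN⟩⟩
  have hsum := sum_prod_div_sub_eq_one b (fun i => (hb i).ne') hbdist
  have hlim := tendsto_finsetSum Finset.univ fun i _ =>
    (tendsto_mul_one_sub_div_mul_exp (hb i) x).const_mul
      (∏ j ∈ Finset.univ.filter (· ≠ i), b i / (b i - b j))
  convert hlim using 2 with a
  · conv_lhs => rw [← hsum, ← Finset.sum_sub_distrib, Finset.mul_sum]
    exact Finset.sum_congr rfl fun i _ => by ring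
  · rw [Finset.mul_sum]
    exact Finset.sum_congr rfl fun i _ => by ring
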